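/- arXiv:2406.17151 — 2 statements merged into one kernel-verified Lean document; each statement's English description precedes it below -/
import Mathlib

section
/- Let $n, m_1, m_2 \in \mathbb{N}$, $c_1, c_2 \in \mathbb{R}^n$, $G_1 \in \mathbb{R}^{n \times m_1}$, $G_2 \in \mathbb{R}^{n \times m_2}$. Then the zonotopes $\mathscr{Z}(c_1, G_1)$ and $\mathscr{Z}(c_2, G_2)$ are disjoint, i.e., $\mathscr{Z}(c_1, G_1) \cap \mathscr{Z}(c_2, G_2) = \emptyset$, if and only if $c_1 \notin \mathscr{Z}(c_2, [G_1 \; G_2])$, where $[G_1 \; G_2] \in \mathbb{R}^{n\times(m_1+m_2)}$ denotes the horizontal concatenation of the generator matrices. -/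
/-- The zonotope in `ℝ^n` with center `c` and generator matrix `G`:
`𝒵(c, G) = {c + Gβ | ‖β‖_∞ ≤ 1}`.  (The norm on `Fin m → ℝ` is the sup norm.) -/
def zonotope {n m : ℕ} (c : Fin n → ℝ) (G : Matrix (Fin n) (Fin m) ℝ) :
    Set (Fin n → ℝ) :=
  {x | ∃ β : Fin m → ℝ, ‖β‖ ≤ 1 ∧ x = c + G.mulVec β}

/-- Horizontal concatenation `[G₁ G₂]` of two generator matrices. -/
def hcat {n m₁ m₂ : ℕ} (G₁ : Matrix (Fin n) (Fin m₁) ℝ)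
    (G₂ : Matrix (Fin n) (Fin m₂) ℝ) : Matrix (Fin n) (Fin (m₁ + m₂)) ℝ :=
  Matrix.of fun i => Fin.append (G₁ i) (G₂ i)

theorem hcat_mulVec_append {n m₁ m₂ : ℕ} (G₁ : Matrix (Fin n) (Fin m₁) ℝ)
    (G₂ : Matrix (Fin n) (Fin m₂) ℝ) (β₁ : Fin m₁ → ℝ) (β₂ : Fin m₂ → ℝ) :
    (hcat G₁ G₂).mulVec (Fin.append β₁ β₂) = G₁.mulVec β₁ + G₂.mulVec β₂ := by
  ext i
  simp [hcat, Matrix.mulVec, dotProduct, Fin.sum_univ_add]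

theorem norm_append_le_iff {m₁ m₂ : ℕ} (β₁ : Fin m₁ → ℝ) (β₂ : Fin m₂ → ℝ) {r : ℝ}
    (hr : 0 ≤ r) : ‖Fin.append β₁ β₂‖ ≤ r ↔ ‖β₁‖ ≤ r ∧ ‖β₂‖ ≤ r := by
  simp only [pi_norm_le_iff_of_nonneg hr]
  refine ⟨fun h => ⟨fun i => ?_, fun i => ?_⟩, fun h i => ?_⟩
  · simpa using h (Fin.castAdd m₂ i)
  · simpa using h (Fin.natAdd m₁ i)
  · refine Fin.addCases (fun j => ?_) (fun j => ?_) i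
    · simpa using h.1 j
    · simpa using h.2 j

theorem mem_zonotope_hcat {n m₁ m₂ : ℕ} (c x : Fin n → ℝ)
    (G₁ : Matrix (Fin n) (Fin m₁) ℝ) (G₂ : Matrix (Fin n) (Fin m₂) ℝ) :
    x ∈ zonotope c (hcat G₁ G₂) ↔
      ∃ β₁ β₂, ‖β₁‖ ≤ 1 ∧ ‖β₂‖ ≤ 1 ∧ x = c + (G₁.mulVec β₁ + G₂.mulVec β₂) := by
  constructor
  · rintro ⟨β, hβ, rfl⟩
    rw [← Fin.append_castAdd_natAdd (f := β)] at hβ ⊢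
    obtain ⟨h₁, h₂⟩ := (norm_append_le_iff _ _ zero_le_one).1 hβ
    exact ⟨_, _, h₁, h₂, by rw [hcat_mulVec_append]⟩
  · rintro ⟨β₁, β₂, h₁, h₂, rfl⟩
    exact ⟨Fin.append β₁ β₂, (norm_append_le_iff _ _ zero_le_one).2 ⟨h₁, h₂⟩,
      by rw [hcat_mulVec_append]⟩

/-- Two zonotopes `𝒵(c₁, G₁)` and `𝒵(c₂, G₂)` are disjoint iff
`c₁ ∉ 𝒵(c₂, [G₁ G₂])`. -/
theorem zonotope_disjoint_iff {n m₁ m₂ : ℕ} (c₁ c₂ : Fin n → ℝ)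
    (G₁ : Matrix (Fin n) (Fin m₁) ℝ) (G₂ : Matrix (Fin n) (Fin m₂) ℝ) :
    zonotope c₁ G₁ ∩ zonotope c₂ G₂ = ∅ ↔ c₁ ∉ zonotope c₂ (hcat G₁ G₂) := by
  rw [← Set.not_nonempty_iff_eq_empty, not_iff_not, mem_zonotope_hcat]
  constructor
  · rintro ⟨x, ⟨β₁, h₁, hx₁⟩, β₂, h₂, hx₂⟩
    refine ⟨-β₁, β₂, by rwa [norm_neg], h₂, ?_⟩
    rw [Matrix.mulVec_neg, eq_sub_of_add_eq (hx₁.symm.trans hx₂)]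
    abel
  · rintro ⟨β₁, β₂, h₁, h₂, hc⟩
    refine ⟨c₂ + G₂.mulVec β₂, ⟨-β₁, by rwa [norm_neg], ?_⟩, β₂, h₂, rfl⟩
    rw [Matrix.mulVec_neg, hc]
    abel
end

section
/- Let $n, m_1, m_2 \in \mathbb{N}$, $c_1, c_2 \in \mathbb{R}^n$, $G_1 \in \mathbb{R}^{n \times m_1}$, $G_2 \in \mathbb{R}^{n \times m_2}$. If $c_1 \notin \mathscr{Z}(c_2, [G_1 \; G_2])$ (the zonotope with center $c_2$ and generator matrix given by horizontal concatenation of $G_1$ and $G_2$), then for every point $p \in \mathscr{Z}(c_1, G_1)$ and every point $q \in \mathscr{Z}(c_2, G_2)$ we have $p \ne q$. (Soundness of the zonotope-based collision-avoidance constraint: an agent constrained to the first zonotope cannot collide with an agent contained in the second.) -/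
/-- The sup norm of a concatenated vector is bounded by a bound on both parts. -/
theorem norm_append_le {m₁ m₂ : ℕ} {β₁ : Fin m₁ → ℝ} {β₂ : Fin m₂ → ℝ} {r : ℝ}
    (hr : 0 ≤ r) (h₁ : ‖β₁‖ ≤ r) (h₂ : ‖β₂‖ ≤ r) : ‖Fin.append β₁ β₂‖ ≤ r := by
  refine (pi_norm_le_iff_of_nonneg hr).2 fun j => ?_
  refine Fin.addCases (fun j => ?_) (fun j => ?_) j
  · simpa using (norm_le_pi_norm β₁ j).trans h₁
  · simpa using (norm_le_pi_norm β₂ j).trans h₂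

/-- Soundness of the zonotope collision-avoidance constraint: if
`c₁ ∉ 𝒵(c₂, [G₁ G₂])`, then no point of `𝒵(c₁, G₁)` coincides with a point of
`𝒵(c₂, G₂)`. -/
theorem zonotope_collision_free {n m₁ m₂ : ℕ} (c₁ c₂ : Fin n → ℝ)
    (G₁ : Matrix (Fin n) (Fin m₁) ℝ) (G₂ : Matrix (Fin n) (Fin m₂) ℝ)
    (h : c₁ ∉ zonotope c₂ (hcat G₁ G₂)) :
    ∀ p ∈ zonotope c₁ G₁, ∀ q ∈ zonotope c₂ G₂, p ≠ q := by
  rintro p ⟨β₁, hβ₁, hp⟩ q ⟨β₂, hβ₂, hq⟩ hpq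
  refine h ⟨Fin.append (-β₁) β₂, norm_append_le zero_le_one (by rwa [norm_neg]) hβ₂, ?_⟩
  have key : c₁ + G₁.mulVec β₁ = c₂ + G₂.mulVec β₂ := by rw [← hp, ← hq, hpq]
  rw [hcat_mulVec_append, Matrix.mulVec_neg, add_left_comm, ← key]
  abel
end
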